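/- For σ, τ, ν ∈ S_η set d^ν_{σ,τ} = D_ν^η(P_σ·P_τ). If ℓ(σ) + ℓ(τ) ≠ ℓ(ν) then d^ν_{σ,τ} ∈ p_η. Moreover d^ν_{ν,id} = d^ν_{id,ν} = 1, where id is the identity of S_η. -/

import Mathlib

open scoped BigOperators

noncomputable section

namespace GTpaper

variable (r : ℕ) (η : Fin r → ℕ)

/-- The index set Σ(η): pairs (k,i) with 1 ≤ k ≤ r, 1 ≤ i ≤ η_k (0-based). -/
abbrev Idx := (k : Fin r) × Fin (η k)

/-- The polynomial ring ℂ[X_η]. -/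
abbrev Pol := MvPolynomial (Idx r η) ℂ

/-- The field of rational functions F = ℂ(X_η). -/
abbrev FF := FractionRing (Pol r η)

/-- The group S_η = S_{η_1} × ⋯ × S_{η_r}. -/
abbrev Sg := ∀ k : Fin r, Equiv.Perm (Fin (η k))

/-- The action of S_η on the index set. -/
def permIdx (σ : Sg r η) : Equiv.Perm (Idx r η) where
  toFun p := ⟨p.1, σ p.1 p.2⟩
  invFun p := ⟨p.1, (σ p.1)⁻¹ p.2⟩
  left_inv p := by simp
  right_inv p := by simp

/-- The action of S_η on ℂ[X_η] by permuting variables. -/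
def actP (σ : Sg r η) : Pol r η ≃+* Pol r η :=
  (MvPolynomial.renameEquiv ℂ (permIdx r η σ)).toRingEquiv

/-- The action of S_η on F = ℂ(X_η) by field automorphisms. -/
def actF (σ : Sg r η) : FF r η ≃+* FF r η :=
  IsFractionRing.ringEquivOfRingEquiv (actP r η σ)

/-- The variable x_{k,i} viewed as an element of F. -/
def XF (p : Idx r η) : FF r η := algebraMap (Pol r η) (FF r η) (MvPolynomial.X p)

/-- The element of S_η which transposes (k,i) and (k,j) and fixes all other indices. -/
def transpT (k : Fin r) (i j : Fin (η k)) : Sg r η :=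
  Function.update (1 : Sg r η) k (Equiv.swap i j)

/-- The simple transposition s_i^{(k)}. -/
def simpleT (k : Fin r) (i : ℕ) (h : i + 1 < η k) : Sg r η :=
  transpT r η k ⟨i, Nat.lt_of_succ_lt h⟩ ⟨i + 1, h⟩

/-- The divided difference operator ∂_i^{(k)} on F. -/
def dd (k : Fin r) (i : ℕ) (h : i + 1 < η k) (f : FF r η) : FF r η :=
  (f - actF r η (simpleT r η k i h) f) /
    (XF r η ⟨k, ⟨i, Nat.lt_of_succ_lt h⟩⟩ - XF r η ⟨k, ⟨i + 1, h⟩⟩)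

/-- Data indexing a simple transposition of S_η. -/
abbrev SimpleDat := (k : Fin r) × {i : ℕ // i + 1 < η k}

/-- A word in the simple transpositions of S_η. -/
abbrev Word := List (SimpleDat r η)

/-- The element of S_η represented by a word. -/
def wordPerm (w : Word r η) : Sg r η :=
  (w.map fun s => simpleT r η s.1 s.2.1 s.2.2).prod

/-- The composite ∂_{j_1} ∘ ⋯ ∘ ∂_{j_l} of divided differences along a word. -/
def ddWord (w : Word r η) (f : FF r η) : FF r η :=
  w.foldr (fun s g => dd r η s.1 s.2.1 s.2.2 g) f

/-- The length ℓ(σ): the total number of inversions of σ. -/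
def len (σ : Sg r η) : ℕ :=
  ∑ k : Fin r,
    (Finset.univ.filter fun p : Fin (η k) × Fin (η k) => p.1 < p.2 ∧ σ k p.2 < σ k p.1).card

/-- `w` is a reduced decomposition of σ. -/
def IsRed (σ : Sg r η) (w : Word r η) : Prop :=
  wordPerm r η w = σ ∧ w.length = len r η σ

/-- The longest word w_η of S_η. -/
def wEta : Sg r η := fun _ => Fin.revPerm

/-- η! = η_1! ⋯ η_r!. -/
def etaFact : ℕ := ∏ k : Fin r, Nat.factorial (η k)

/-- The Vandermonde-type product Δ_η as a polynomial. -/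
def DeltaP : Pol r η :=
  ∏ k : Fin r, ∏ p ∈ Finset.univ.filter (fun p : Fin (η k) × Fin (η k) => p.1 < p.2),
    (MvPolynomial.X (⟨k, p.1⟩ : Idx r η) - MvPolynomial.X (⟨k, p.2⟩ : Idx r η))

/-- Δ_η as an element of F. -/
def DeltaF : FF r η := algebraMap (Pol r η) (FF r η) (DeltaP r η)

/-- The symmetrization operator sym_η on F. -/
def symF (f : FF r η) : FF r η :=
  (etaFact r η : FF r η)⁻¹ * ∑ σ : Sg r η, actF r η σ f

/-- The sign of an element of S_η. -/
def sgn (σ : Sg r η) : ℤ := ∏ k : Fin r, (Equiv.Perm.sign (σ k) : ℤ)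

/-- The antisymmetrization operator asym_η on F. -/
def asymF (f : FF r η) : FF r η :=
  (etaFact r η : FF r η)⁻¹ * ∑ σ : Sg r η, (sgn r η σ : FF r η) * actF r η σ f

/-- The ideal p_η of ℂ[X_η] generated by the differences x_{k,i} - x_{k,j}. -/
def pIdeal : Ideal (Pol r η) :=
  Ideal.span {q | ∃ (k : Fin r) (i j : Fin (η k)), i < j ∧
    q = MvPolynomial.X (⟨k, i⟩ : Idx r η) - MvPolynomial.X (⟨k, j⟩ : Idx r η)}

section Helpers

variable {r : ℕ} {η : Fin r → ℕ}

lemma actF_algebraMap (σ : Sg r η) (p : Pol r η) :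
    actF r η σ (algebraMap _ _ p) = algebraMap _ (FF r η) (actP r η σ p) := by
  simp [actF]

lemma actP_X (σ : Sg r η) (p : Idx r η) :
    actP r η σ (MvPolynomial.X p) = MvPolynomial.X (permIdx r η σ p) := by
  simp [actP]

lemma actF_XF (σ : Sg r η) (p : Idx r η) :
    actF r η σ (XF r η p) = XF r η (permIdx r η σ p) := by
  rw [XF, actF_algebraMap, actP_X, XF]

lemma XF_injective : Function.Injective (XF r η) :=
  (IsFractionRing.injective (Pol r η) (FF r η)).comp (MvPolynomial.X_injective)

lemma actP_mul (σ τ : Sg r η) (p : Pol r η) :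
    actP r η (σ * τ) p = actP r η σ (actP r η τ p) := by
  simp only [actP, AlgEquiv.coe_ringEquiv,
    MvPolynomial.renameEquiv_apply, MvPolynomial.rename_rename]
  rfl

lemma actF_mul (σ τ : Sg r η) (f : FF r η) :
    actF r η (σ * τ) f = actF r η σ (actF r η τ f) := by
  obtain ⟨a, b, -, rfl⟩ := IsFractionRing.div_surjective (A := Pol r η) f
  simp only [map_div₀, actF_algebraMap, actP_mul]

lemma actF_one (f : FF r η) : actF r η 1 f = f := by
  have h (p : Pol r η) : actP r η 1 p = p := by
    have : (permIdx r η 1 : Idx r η → Idx r η) = id := rfl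
    simp [actP, this]
  obtain ⟨a, b, -, rfl⟩ := IsFractionRing.div_surjective (A := Pol r η) f
  simp only [map_div₀, actF_algebraMap, h]

lemma actF_algebraMap_complex (σ : Sg r η) (c : ℂ) :
    actF r η σ (algebraMap ℂ (FF r η) c) = algebraMap ℂ (FF r η) c := by
  rw [IsScalarTower.algebraMap_apply ℂ (Pol r η) (FF r η), actF_algebraMap]
  simp [actP]

lemma actF_smul (σ : Sg r η) (c : ℂ) (f : FF r η) :
    actF r η σ (c • f) = c • actF r η σ f := by
  rw [Algebra.smul_def, map_mul, actF_algebraMap_complex, Algebra.smul_def]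

/-- The action of an element of `S_η` on `F` as a homomorphism of ℂ-algebras. -/
def actHom (σ : Sg r η) : FF r η →ₐ[ℂ] FF r η :=
  { (actF r η σ : FF r η →+* FF r η) with commutes' := actF_algebraMap_complex σ }

lemma actHom_apply (σ : Sg r η) (f : FF r η) : actHom σ f = actF r η σ f := rfl

lemma permIdx_injective : Function.Injective (permIdx r η) := by
  intro σ τ h
  funext k
  ext i : 1
  simpa [permIdx] using congrArg (fun e => e ⟨k, i⟩) h

lemma eq_of_actF_eq {σ τ : Sg r η} (h : ∀ f, actF r η σ f = actF r η τ f) : σ = τ :=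
  permIdx_injective <| Equiv.ext fun p => XF_injective <| by
    simpa only [actF_XF] using h (XF r η p)

/-- The degree-one part of the algebra of differences of variables within a block. -/
def diffSpan (r : ℕ) (η : Fin r → ℕ) : Submodule ℂ (FF r η) :=
  Submodule.span ℂ {f | ∃ (k : Fin r) (i j : Fin (η k)), f = XF r η ⟨k, i⟩ - XF r η ⟨k, j⟩}

lemma sub_mem_diffSpan (k : Fin r) (i j : Fin (η k)) :
    XF r η ⟨k, i⟩ - XF r η ⟨k, j⟩ ∈ diffSpan r η :=
  Submodule.subset_span ⟨k, i, j, rfl⟩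

lemma map_actHom_diffSpan_le (σ : Sg r η) :
    (diffSpan r η).map (actHom σ).toLinearMap ≤ diffSpan r η := by
  rw [diffSpan, Submodule.map_span, Submodule.span_le]
  rintro _ ⟨_, ⟨k, i, j, rfl⟩, rfl⟩
  rw [← diffSpan]
  simpa [actHom_apply, actF_XF, permIdx] using sub_mem_diffSpan k (σ k i) (σ k j)

lemma actF_mem_diffSpan_pow (σ : Sg r η) {d : ℕ} {f : FF r η} (hf : f ∈ diffSpan r η ^ d) :
    actF r η σ f ∈ diffSpan r η ^ d := by
  have h : actF r η σ f ∈ (diffSpan r η ^ d).map (actHom σ).toLinearMap := ⟨f, hf, rfl⟩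
  rw [Submodule.map_pow] at h
  exact pow_le_pow_left' (map_actHom_diffSpan_le σ) d h

lemma symF_mem_diffSpan_pow {d : ℕ} {f : FF r η} (hf : f ∈ diffSpan r η ^ d) :
    symF r η f ∈ diffSpan r η ^ d := by
  have h : symF r η f = ((etaFact r η : ℂ)⁻¹) • ∑ σ : Sg r η, actF r η σ f := by
    rw [symF, Algebra.smul_def]; simp
  rw [h]
  exact Submodule.smul_mem _ _ (Submodule.sum_mem _ fun σ _ => actF_mem_diffSpan_pow σ hf)

lemma etaFact_ne_zero : (etaFact r η : FF r η) ≠ 0 := by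
  rw [Nat.cast_ne_zero, etaFact, Finset.prod_ne_zero_iff]
  exact fun k _ => Nat.factorial_ne_zero _

lemma card_Sg : Fintype.card (Sg r η) = etaFact r η := by
  simp [etaFact, Fintype.card_perm]

lemma symF_of_invariant {f : FF r η} (hf : ∀ σ, actF r η σ f = f) : symF r η f = f := by
  simp only [symF, hf, Finset.sum_const, Finset.card_univ, card_Sg, nsmul_eq_mul]
  exact inv_mul_cancel_left₀ etaFact_ne_zero f

lemma actF_symF (τ : Sg r η) (f : FF r η) : actF r η τ (symF r η f) = symF r η f := by
  simp only [symF, map_mul, map_inv₀, map_natCast, map_sum, ← actF_mul]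
  congr 1
  exact Fintype.sum_equiv (Equiv.mulLeft τ) _ _ fun σ => rfl

lemma symF_actF (τ : Sg r η) (f : FF r η) : symF r η (actF r η τ f) = symF r η f := by
  simp only [symF, ← actF_mul]
  congr 1
  exact Fintype.sum_equiv (Equiv.mulRight τ) _ _ fun σ => rfl

lemma symF_sub (f g : FF r η) : symF r η (f - g) = symF r η f - symF r η g := by
  simp only [symF, map_sub, Finset.sum_sub_distrib, mul_sub]

lemma symF_zero : symF r η 0 = 0 := by simp [symF]

lemma simpleT_mul_self (k : Fin r) (i : ℕ) (h : i + 1 < η k) :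
    simpleT r η k i h * simpleT r η k i h = 1 := by
  funext l
  by_cases hl : l = k
  · subst hl; simp [simpleT, transpT]
  · simp [simpleT, transpT, hl]

lemma XF_sub_ne_zero {p q : Idx r η} (h : p ≠ q) : XF r η p - XF r η q ≠ 0 :=
  sub_ne_zero.2 fun e => h (XF_injective e)

lemma permIdx_simpleT (k : Fin r) (i : ℕ) (h : i + 1 < η k) (j : Fin (η k)) :
    permIdx r η (simpleT r η k i h) ⟨k, j⟩ =
      ⟨k, Equiv.swap ⟨i, Nat.lt_of_succ_lt h⟩ ⟨i + 1, h⟩ j⟩ := by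
  simp [permIdx, simpleT, transpT]

lemma permIdx_simpleT_of_ne (k : Fin r) (i : ℕ) (h : i + 1 < η k) {l : Fin r} (hl : l ≠ k)
    (j : Fin (η l)) : permIdx r η (simpleT r η k i h) ⟨l, j⟩ = ⟨l, j⟩ := by
  simp [permIdx, simpleT, transpT, hl]

lemma dd_algebraMap (k : Fin r) (i : ℕ) (h : i + 1 < η k) (c : ℂ) :
    dd r η k i h (algebraMap ℂ _ c) = 0 := by
  simp [dd, actF_algebraMap_complex]

lemma dd_mul (k : Fin r) (i : ℕ) (h : i + 1 < η k) (f g : FF r η) :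
    dd r η k i h (f * g) =
      dd r η k i h f * g + actF r η (simpleT r η k i h) f * dd r η k i h g := by
  simp only [dd, map_mul]; ring

lemma dd_add (k : Fin r) (i : ℕ) (h : i + 1 < η k) (f g : FF r η) :
    dd r η k i h (f + g) = dd r η k i h f + dd r η k i h g := by
  simp only [dd, map_add]; ring

lemma dd_sub (k : Fin r) (i : ℕ) (h : i + 1 < η k) (f g : FF r η) :
    dd r η k i h (f - g) = dd r η k i h f - dd r η k i h g := by
  simp only [dd, map_sub]; ring

lemma dd_smul (k : Fin r) (i : ℕ) (h : i + 1 < η k) (c : ℂ) (f : FF r η) :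
    dd r η k i h (c • f) = c • dd r η k i h f := by
  simp only [dd, actF_smul, ← smul_sub, smul_div_assoc]

lemma simple_root_ne_zero (k : Fin r) (i : ℕ) (h : i + 1 < η k) :
    XF r η ⟨k, ⟨i, Nat.lt_of_succ_lt h⟩⟩ - XF r η ⟨k, ⟨i + 1, h⟩⟩ ≠ 0 :=
  XF_sub_ne_zero (by simp)

lemma actF_simple_root (k : Fin r) (i : ℕ) (h : i + 1 < η k) :
    actF r η (simpleT r η k i h)
        (XF r η ⟨k, ⟨i, Nat.lt_of_succ_lt h⟩⟩ - XF r η ⟨k, ⟨i + 1, h⟩⟩) =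
      -(XF r η ⟨k, ⟨i, Nat.lt_of_succ_lt h⟩⟩ - XF r η ⟨k, ⟨i + 1, h⟩⟩) := by
  simp only [map_sub, actF_XF, permIdx_simpleT, Equiv.swap_apply_left, Equiv.swap_apply_right,
    neg_sub]

lemma sub_div_neg_swap {K : Type*} [Field K] (a b x : K) : (b - a) / -x = (a - b) / x := by
  rw [div_neg, ← neg_div, neg_sub]

lemma dd_dd (k : Fin r) (i : ℕ) (h : i + 1 < η k) (f : FF r η) :
    dd r η k i h (dd r η k i h f) = 0 := by
  have h1 : actF r η (simpleT r η k i h) (dd r η k i h f) = dd r η k i h f := by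
    simp only [dd, map_div₀, actF_simple_root, map_sub (actF r η (simpleT r η k i h)) f,
      ← actF_mul, simpleT_mul_self, actF_one]
    exact sub_div_neg_swap _ _ _
  rw [dd, h1, sub_self, zero_div]

lemma dd_XF_mem (k : Fin r) (i : ℕ) (h : i + 1 < η k) (p : Idx r η) :
    dd r η k i h (XF r η p) ∈ (1 : Submodule ℂ (FF r η)) := by
  obtain ⟨l, j⟩ := p
  have h0 := simple_root_ne_zero k i h
  by_cases hl : l = k
  · subst hl
    by_cases h1 : j = ⟨i, Nat.lt_of_succ_lt h⟩
    · subst h1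
      rw [dd, actF_XF, permIdx_simpleT, Equiv.swap_apply_left, div_self h0]
      exact Submodule.one_le.1 le_rfl
    by_cases h2 : j = ⟨i + 1, h⟩
    · subst h2
      rw [dd, actF_XF, permIdx_simpleT, Equiv.swap_apply_right, ← neg_sub]
      have h3 := neg_div_self h0
      exact h3 ▸ Submodule.neg_mem _ (Submodule.one_le.1 le_rfl)
    rw [dd, actF_XF, permIdx_simpleT, Equiv.swap_apply_of_ne_of_ne h1 h2, sub_self, zero_div]
    exact Submodule.zero_mem _
  · rw [dd, actF_XF, permIdx_simpleT_of_ne _ _ _ hl, sub_self, zero_div]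
    exact Submodule.zero_mem _

lemma dd_mem_of_mem_diffSpan (k : Fin r) (i : ℕ) (h : i + 1 < η k) {f : FF r η}
    (hf : f ∈ diffSpan r η) : dd r η k i h f ∈ (1 : Submodule ℂ (FF r η)) := by
  induction hf using Submodule.span_induction with
  | mem x hx =>
    obtain ⟨l, a, b, rfl⟩ := hx
    rw [dd_sub]
    exact Submodule.sub_mem _ (dd_XF_mem ..) (dd_XF_mem ..)
  | zero => simp [dd]
  | add x y _ _ hx hy => rw [dd_add]; exact Submodule.add_mem _ hx hy
  | smul c x _ hx => rw [dd_smul]; exact Submodule.smul_mem _ _ hx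

lemma dd_eq_zero_of_mem_pow_zero (k : Fin r) (i : ℕ) (h : i + 1 < η k) {f : FF r η}
    (hf : f ∈ diffSpan r η ^ 0) : dd r η k i h f = 0 := by
  rw [pow_zero, Submodule.mem_one] at hf
  obtain ⟨c, rfl⟩ := hf
  exact dd_algebraMap k i h c

lemma dd_mem_diffSpan_pow (k : Fin r) (i : ℕ) (h : i + 1 < η k) (d : ℕ) :
    ∀ f ∈ diffSpan r η ^ (d + 1), dd r η k i h f ∈ diffSpan r η ^ d := by
  induction d with
  | zero =>
    intro f hf
    rw [zero_add, pow_one] at hf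
    simpa using dd_mem_of_mem_diffSpan k i h hf
  | succ d ih =>
    intro f hf
    rw [pow_succ'] at hf
    induction hf using Submodule.mul_induction_on' with
    | mem_mul_mem v hv g hg =>
      rw [dd_mul]
      refine Submodule.add_mem _ ?_ ?_
      · have := Submodule.mul_mem_mul (dd_mem_of_mem_diffSpan k i h hv) hg
        rwa [one_mul] at this
      · rw [pow_succ']
        refine Submodule.mul_mem_mul ?_ (ih g hg)
        have := actF_mem_diffSpan_pow (simpleT r η k i h) (d := 1) (f := v) (by simpa using hv)
        simpa using this
    | add x _ y _ hx hy => rw [dd_add]; exact Submodule.add_mem _ hx hy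

lemma ddWord_mem_diffSpan_pow (w : Word r η) (d : ℕ) {f : FF r η}
    (hf : f ∈ diffSpan r η ^ (d + w.length)) : ddWord r η w f ∈ diffSpan r η ^ d := by
  induction w generalizing d with
  | nil => simpa [ddWord] using hf
  | cons s w ih =>
    refine dd_mem_diffSpan_pow _ _ _ d _ (ih (d + 1) ?_)
    rwa [add_assoc, add_comm 1, ← List.length_cons]

lemma dd_zero (k : Fin r) (i : ℕ) (h : i + 1 < η k) : dd r η k i h 0 = 0 := by simp [dd]

lemma ddWord_eq_zero_of_lt (w : Word r η) {d : ℕ} (hd : d < w.length) {f : FF r η}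
    (hf : f ∈ diffSpan r η ^ d) : ddWord r η w f = 0 := by
  induction w with
  | nil => simp at hd
  | cons s w ih =>
    rcases (Nat.lt_succ_iff.1 hd).lt_or_eq with h | rfl
    · change dd r η _ _ _ (ddWord r η w f) = 0
      rw [ih h, dd_zero]
    · exact dd_eq_zero_of_mem_pow_zero _ _ _ (ddWord_mem_diffSpan_pow w 0 (by simpa using hf))

lemma exists_mem_pIdeal {d : ℕ} (hd : d ≠ 0) {f : FF r η} (hf : f ∈ diffSpan r η ^ d) :
    ∃ q ∈ pIdeal r η, f = algebraMap (Pol r η) (FF r η) q := by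
  let J : Submodule ℂ (FF r η) := ((pIdeal r η).restrictScalars ℂ).map
    (IsScalarTower.toAlgHom ℂ (Pol r η) (FF r η)).toLinearMap
  have hV : diffSpan r η ≤ J := by
    rw [diffSpan, Submodule.span_le]
    rintro _ ⟨k, i, j, rfl⟩
    refine ⟨MvPolynomial.X ⟨k, i⟩ - MvPolynomial.X ⟨k, j⟩, ?_, by simp [XF]⟩
    rcases lt_trichotomy i j with h | rfl | h
    · exact Ideal.subset_span ⟨k, i, j, h, rfl⟩
    · simp
    · rw [← neg_sub]
      exact neg_mem (Ideal.subset_span ⟨k, j, i, h, rfl⟩)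
  suffices ∀ d, diffSpan r η ^ (d + 1) ≤ J by
    obtain ⟨e, rfl⟩ := Nat.exists_eq_succ_of_ne_zero hd
    obtain ⟨q, hq, rfl⟩ := this e hf
    exact ⟨q, hq, rfl⟩
  intro d
  induction d with
  | zero => simpa using hV
  | succ d ih =>
    rw [pow_succ', Submodule.mul_le]
    intro v hv g hg
    obtain ⟨p, hp, rfl⟩ := hV hv
    obtain ⟨q, hq, rfl⟩ := ih hg
    exact ⟨p * q, Ideal.mul_mem_left _ _ hq, by simp⟩

/-- The number of inversions of a permutation of `Fin n`. -/
def invCard {n : ℕ} (π : Equiv.Perm (Fin n)) : ℕ :=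
  (Finset.univ.filter fun p : Fin n × Fin n => p.1 < p.2 ∧ π p.2 < π p.1).card

lemma len_eq_sum_invCard (σ : Sg r η) : len r η σ = ∑ k, invCard (σ k) := rfl

lemma swap_succ_lt_iff {n : ℕ} (i : ℕ) (h : i + 1 < n) (x y : Fin n) :
    Equiv.swap (⟨i, Nat.lt_of_succ_lt h⟩ : Fin n) ⟨i + 1, h⟩ y <
        Equiv.swap ⟨i, Nat.lt_of_succ_lt h⟩ ⟨i + 1, h⟩ x ↔
      (x = ⟨i, Nat.lt_of_succ_lt h⟩ ∧ y = ⟨i + 1, h⟩) ∨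
        (y < x ∧ ¬ (x = ⟨i + 1, h⟩ ∧ y = ⟨i, Nat.lt_of_succ_lt h⟩)) := by
  simp only [Equiv.swap_apply_def, Fin.lt_def, Fin.ext_iff]
  split_ifs <;> (try dsimp only) <;> omega

lemma invCard_swap_mul {n : ℕ} (π : Equiv.Perm (Fin n)) (i : ℕ) (h : i + 1 < n)
    (hlt : π⁻¹ ⟨i, Nat.lt_of_succ_lt h⟩ < π⁻¹ ⟨i + 1, h⟩) :
    invCard (Equiv.swap ⟨i, Nat.lt_of_succ_lt h⟩ ⟨i + 1, h⟩ * π) = invCard π + 1 := by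
  have hnot : (π⁻¹ ⟨i, Nat.lt_of_succ_lt h⟩, π⁻¹ ⟨i + 1, h⟩) ∉
      Finset.univ.filter fun p : Fin n × Fin n => p.1 < p.2 ∧ π p.2 < π p.1 := by
    simp
  rw [invCard, invCard, ← Finset.card_insert_of_notMem hnot]
  congr 1
  ext ⟨p, q⟩
  rw [Finset.mem_insert, Finset.mem_filter, Finset.mem_filter, Prod.mk.injEq,
    Equiv.Perm.eq_inv_iff_eq, Equiv.Perm.eq_inv_iff_eq]
  simp only [Finset.mem_univ, true_and, Equiv.Perm.mul_apply, swap_succ_lt_iff]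
  have h1 : π p = ⟨i, Nat.lt_of_succ_lt h⟩ ∧ π q = ⟨i + 1, h⟩ → p < q := by
    rintro ⟨hp, hq⟩
    rwa [← Equiv.Perm.eq_inv_iff_eq.2 hp, ← Equiv.Perm.eq_inv_iff_eq.2 hq] at hlt
  have h2 : π p = ⟨i + 1, h⟩ ∧ π q = ⟨i, Nat.lt_of_succ_lt h⟩ → ¬ p < q := by
    rintro ⟨hp, hq⟩
    rw [← Equiv.Perm.eq_inv_iff_eq.2 hp, ← Equiv.Perm.eq_inv_iff_eq.2 hq] at hlt
    exact hlt.not_gt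
  tauto

lemma len_simpleT_mul_of_lt (k : Fin r) (i : ℕ) (h : i + 1 < η k) (σ : Sg r η)
    (hlt : (σ k)⁻¹ ⟨i, Nat.lt_of_succ_lt h⟩ < (σ k)⁻¹ ⟨i + 1, h⟩) :
    len r η (simpleT r η k i h * σ) = len r η σ + 1 := by
  rw [len_eq_sum_invCard, len_eq_sum_invCard, ← Finset.add_sum_erase _ _ (Finset.mem_univ k),
    ← Finset.add_sum_erase _ (fun k => invCard (σ k)) (Finset.mem_univ k)]
  have h1 : (simpleT r η k i h * σ) k =
      Equiv.swap ⟨i, Nat.lt_of_succ_lt h⟩ ⟨i + 1, h⟩ * σ k := by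
    simp [simpleT, transpT]
  have h2 : ∑ l ∈ Finset.univ.erase k, invCard ((simpleT r η k i h * σ) l) =
      ∑ l ∈ Finset.univ.erase k, invCard (σ l) :=
    Finset.sum_congr rfl fun l hl => by
      simp [simpleT, transpT, Finset.ne_of_mem_erase hl]
  rw [h1, h2, invCard_swap_mul _ _ _ hlt]
  ring

lemma len_simpleT_mul_of_gt (k : Fin r) (i : ℕ) (h : i + 1 < η k) (σ : Sg r η)
    (hlt : (σ k)⁻¹ ⟨i + 1, h⟩ < (σ k)⁻¹ ⟨i, Nat.lt_of_succ_lt h⟩) :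
    len r η (simpleT r η k i h * σ) + 1 = len r η σ := by
  rw [← len_simpleT_mul_of_lt k i h (simpleT r η k i h * σ), ← mul_assoc, simpleT_mul_self,
    one_mul]
  simpa [simpleT, transpT] using hlt

lemma len_simpleT_mul (k : Fin r) (i : ℕ) (h : i + 1 < η k) (σ : Sg r η) :
    len r η (simpleT r η k i h * σ) = len r η σ + 1 ∨
      len r η (simpleT r η k i h * σ) + 1 = len r η σ := by
  have hne : (σ k)⁻¹ ⟨i, Nat.lt_of_succ_lt h⟩ ≠ (σ k)⁻¹ ⟨i + 1, h⟩ := by simp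
  exact hne.lt_or_gt.imp (len_simpleT_mul_of_lt k i h σ) (len_simpleT_mul_of_gt k i h σ)

lemma perm_eq_one_of_lt_succ {n : ℕ} (π : Equiv.Perm (Fin n))
    (hπ : ∀ (i : ℕ) (h : i + 1 < n), π ⟨i, Nat.lt_of_succ_lt h⟩ < π ⟨i + 1, h⟩) : π = 1 := by
  cases n with
  | zero => exact Subsingleton.elim _ _
  | succ n =>
    have hm : StrictMono π := Fin.strictMono_iff_lt_succ.2 fun i => hπ i (by omega)
    have h : (π : Fin (n + 1) → Fin (n + 1)) = id :=
      (hm.range_inj strictMono_id).1 (by simp [π.surjective.range_eq])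
    exact Equiv.ext fun i => congrFun h i

lemma exists_descent {σ : Sg r η} (hσ : σ ≠ 1) :
    ∃ (k : Fin r) (i : ℕ) (h : i + 1 < η k), len r η (simpleT r η k i h * σ) + 1 = len r η σ := by
  by_contra! hcon
  refine hσ (funext fun k => inv_eq_one.1 (perm_eq_one_of_lt_succ _ fun i h => ?_))
  by_contra hlt
  have hne : (σ k)⁻¹ ⟨i, Nat.lt_of_succ_lt h⟩ ≠ (σ k)⁻¹ ⟨i + 1, h⟩ := by simp
  exact hcon k i h (len_simpleT_mul_of_gt k i h σ (hne.lt_or_gt.resolve_left hlt))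

lemma len_one : len r η 1 = 0 := by
  exact Finset.sum_eq_zero fun k _ => Finset.card_eq_zero.2 <|
    Finset.filter_eq_empty_iff.2 fun p _ h => h.1.not_gt h.2

lemma wordPerm_cons (s : SimpleDat r η) (w : Word r η) :
    wordPerm r η (s :: w) = simpleT r η s.1 s.2.1 s.2.2 * wordPerm r η w := by
  simp [wordPerm]

lemma wordPerm_append (v w : Word r η) :
    wordPerm r η (v ++ w) = wordPerm r η v * wordPerm r η w := by
  simp [wordPerm]

lemma wordPerm_reverse (w : Word r η) :
    wordPerm r η w.reverse = (wordPerm r η w)⁻¹ := by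
  induction w with
  | nil => simp [wordPerm]
  | cons s w ih =>
    rw [List.reverse_cons, wordPerm_append, ih, wordPerm_cons s w, mul_inv_rev]
    congr 1
    rw [eq_inv_iff_mul_eq_one]
    simp [wordPerm, simpleT_mul_self]

lemma ddWord_cons (s : SimpleDat r η) (w : Word r η) (f : FF r η) :
    ddWord r η (s :: w) f = dd r η s.1 s.2.1 s.2.2 (ddWord r η w f) := rfl

lemma ddWord_append (v w : Word r η) (f : FF r η) :
    ddWord r η (v ++ w) f = ddWord r η v (ddWord r η w f) := by
  simp [ddWord]

lemma exists_isRed (σ : Sg r η) : ∃ w, IsRed r η σ w := by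
  induction hn : len r η σ generalizing σ with
  | zero =>
    refine ⟨[], ?_, by simp [hn]⟩
    by_contra h
    obtain ⟨k, i, hi, hd⟩ := exists_descent (σ := σ) (fun e => h (by simp [wordPerm, e]))
    omega
  | succ n ih =>
    have hσ : σ ≠ 1 := by rintro rfl; simp [len_one] at hn
    obtain ⟨k, i, hi, hd⟩ := exists_descent hσ
    obtain ⟨w, hw, hl⟩ := ih (simpleT r η k i hi * σ) (by omega)
    refine ⟨⟨k, i, hi⟩ :: w, ?_, by simp only [List.length_cons]; omega⟩
    rw [wordPerm_cons, hw, ← mul_assoc, simpleT_mul_self, one_mul]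

lemma eq_one_of_len_eq_zero {σ : Sg r η} (h : len r η σ = 0) : σ = 1 := by
  by_contra hσ
  obtain ⟨k, i, hi, hd⟩ := exists_descent hσ
  omega

lemma len_inv (σ : Sg r η) : len r η σ⁻¹ = len r η σ := by
  refine Finset.sum_congr rfl fun k _ => ?_
  refine Finset.card_nbij' (fun p => ((σ k)⁻¹ p.2, (σ k)⁻¹ p.1)) (fun p => (σ k p.2, σ k p.1))
    ?_ ?_ ?_ ?_ <;> intro p <;> simp +contextual

lemma invCard_mul_revPerm {n : ℕ} (π : Equiv.Perm (Fin n)) :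
    invCard (π * Fin.revPerm) + invCard π = invCard (Fin.revPerm : Equiv.Perm (Fin n)) := by
  have h1 : invCard (π * Fin.revPerm) =
      (Finset.univ.filter fun p : Fin n × Fin n => p.1 < p.2 ∧ π p.1 < π p.2).card := by
    refine Finset.card_nbij' (fun p => (p.2.rev, p.1.rev)) (fun p => (p.2.rev, p.1.rev))
      ?_ ?_ ?_ ?_ <;> intro p <;> simp +contextual
  rw [h1, invCard, invCard, ← Finset.card_union_of_disjoint]
  · congr 1
    ext p
    have h2 : p.1 < p.2 → π p.1 ≠ π p.2 := fun h e => h.ne (π.injective e)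
    have h3 : p.1 < p.2 → (π p.1 < π p.2 ∨ π p.2 < π p.1) := fun h => (h2 h).lt_or_gt
    simp only [Finset.mem_union, Finset.mem_filter, Finset.mem_univ, true_and, Fin.revPerm_apply,
      Fin.rev_lt_rev, and_self]
    tauto
  · rw [Finset.disjoint_filter]
    exact fun p _ h h' => h.2.not_gt h'.2

lemma len_mul_wEta (σ : Sg r η) :
    len r η (σ * wEta r η) + len r η σ = len r η (wEta r η) := by
  simp only [len_eq_sum_invCard, ← Finset.sum_add_distrib]
  exact Finset.sum_congr rfl fun k _ => invCard_mul_revPerm (σ k)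

lemma wEta_inv : (wEta r η)⁻¹ = wEta r η := by
  funext k
  rfl

lemma eq_one_of_len_mul_wEta {σ : Sg r η} (h : len r η (σ * wEta r η) = len r η (wEta r η)) :
    σ = 1 :=
  eq_one_of_len_eq_zero (by have := len_mul_wEta σ; omega)

lemma prod_mem_pow_sum {R A ι : Type*} [CommSemiring R] [CommSemiring A] [Algebra R A]
    (M : Submodule R A) (s : Finset ι) (f : ι → A) (d : ι → ℕ)
    (hf : ∀ i ∈ s, f i ∈ M ^ d i) : ∏ i ∈ s, f i ∈ M ^ ∑ i ∈ s, d i := by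
  classical
  induction s using Finset.induction_on with
  | empty => simpa using Submodule.one_le.1 (le_refl (1 : Submodule R A))
  | insert i s hi ih =>
    rw [Finset.prod_insert hi, Finset.sum_insert hi, pow_add]
    exact Submodule.mul_mem_mul (hf i (by simp)) (ih fun j hj => hf j (by simp [hj]))

lemma DeltaF_eq : DeltaF r η =
    ∏ k : Fin r, ∏ p ∈ Finset.univ.filter (fun p : Fin (η k) × Fin (η k) => p.1 < p.2),
      (XF r η ⟨k, p.1⟩ - XF r η ⟨k, p.2⟩) := by
  simp only [DeltaF, DeltaP, map_prod, map_sub, XF]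

lemma DeltaF_ne_zero : DeltaF r η ≠ 0 := by
  rw [DeltaF_eq]
  refine Finset.prod_ne_zero_iff.2 fun k _ => Finset.prod_ne_zero_iff.2 fun p hp => ?_
  exact XF_sub_ne_zero (by simpa using (Finset.mem_filter.1 hp).2.ne)

lemma DeltaF_mem : DeltaF r η ∈ diffSpan r η ^ len r η (wEta r η) := by
  rw [DeltaF_eq, len_eq_sum_invCard]
  refine prod_mem_pow_sum _ _ _ _ fun k _ => ?_
  have h := prod_mem_pow_sum (diffSpan r η)
    (Finset.univ.filter (fun p : Fin (η k) × Fin (η k) => p.1 < p.2))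
    (fun p => XF r η ⟨k, p.1⟩ - XF r η ⟨k, p.2⟩) (fun _ => 1)
    (fun p _ => by simpa using sub_mem_diffSpan k p.1 p.2)
  simpa [invCard, wEta] using h

lemma actF_DeltaF (k : Fin r) (i : ℕ) (h : i + 1 < η k) :
    actF r η (simpleT r η k i h) (DeltaF r η) = -DeltaF r η := by
  have hprod (l : Fin r) (g : Fin (η l) → Fin (η l) → FF r η) :
      ∏ p ∈ Finset.univ.filter (fun p : Fin (η l) × Fin (η l) => p.1 < p.2), g p.1 p.2 =
        ∏ a, ∏ b ∈ Finset.Ioi a, g a b :=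
    Finset.prod_finset_product _ _ _ (by simp)
  rw [DeltaF_eq]
  simp only [map_prod, map_sub, actF_XF]
  rw [← Finset.mul_prod_erase _ _ (Finset.mem_univ k), ← neg_one_mul,
    ← Finset.mul_prod_erase _ (fun l => ∏ p ∈ Finset.univ.filter
      (fun p : Fin (η l) × Fin (η l) => p.1 < p.2), (XF r η ⟨l, p.1⟩ - XF r η ⟨l, p.2⟩))
      (Finset.mem_univ k), ← mul_assoc]
  congr 1
  · simp only [permIdx_simpleT]
    rw [hprod k fun a b => XF r η ⟨k, Equiv.swap _ _ a⟩ - XF r η ⟨k, Equiv.swap _ _ b⟩,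
      hprod k fun a b => XF r η ⟨k, a⟩ - XF r η ⟨k, b⟩]
    have := Equiv.Perm.prod_Ioi_comp_eq_sign_mul_prod
      (Equiv.swap (⟨i, Nat.lt_of_succ_lt h⟩ : Fin (η k)) ⟨i + 1, h⟩)
      (f := fun a b => XF r η ⟨k, a⟩ - XF r η ⟨k, b⟩) (fun a b => (neg_sub _ _).symm)
    rw [this, Equiv.Perm.sign_swap (by simp)]
    simp
  · refine Finset.prod_congr rfl fun l hl => Finset.prod_congr rfl fun p _ => ?_
    rw [permIdx_simpleT_of_ne _ _ _ (Finset.ne_of_mem_erase hl),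
      permIdx_simpleT_of_ne _ _ _ (Finset.ne_of_mem_erase hl)]

lemma sub_div_mul_div {K : Type*} [Field K] (a b x g y : K) :
    (a - b) / x * (g / y) = a * (g / (x * y)) - b * (g / (x * y)) := by
  rw [← sub_mul, div_mul_div_comm, mul_div_assoc]

lemma mul_sub_div_div {K : Type*} [Field K] (f a b x y : K) :
    f * ((a - b) / x / y) = f * (a / (x * y)) - f * (b / (x * y)) := by
  rw [← mul_sub, ← sub_div, div_div]

lemma symF_dd_mul_div (k : Fin r) (i : ℕ) (h : i + 1 < η k) (f g : FF r η) :
    symF r η (dd r η k i h f * (g / DeltaF r η)) =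
      symF r η (f * (dd r η k i h g / DeltaF r η)) := by
  set s := simpleT r η k i h
  set α := XF r η ⟨k, ⟨i, Nat.lt_of_succ_lt h⟩⟩ - XF r η ⟨k, ⟨i + 1, h⟩⟩ with hα
  have h1 : dd r η k i h f * (g / DeltaF r η) =
      f * (g / (α * DeltaF r η)) - actF r η s f * (g / (α * DeltaF r η)) := by
    simp only [dd]; rw [← hα]
    exact sub_div_mul_div ..
  have h2 : f * (dd r η k i h g / DeltaF r η) =
      f * (g / (α * DeltaF r η)) - f * (actF r η s g / (α * DeltaF r η)) := by
    simp only [dd]; rw [← hα]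
    exact mul_sub_div_div ..
  have h3 : actF r η s (actF r η s f * (g / (α * DeltaF r η))) =
      f * (actF r η s g / (α * DeltaF r η)) := by
    rw [map_mul, ← actF_mul, simpleT_mul_self, actF_one, map_div₀, map_mul, actF_DeltaF,
      actF_simple_root]
    congr 2
    exact neg_mul_neg _ _
  rw [h1, h2, symF_sub, symF_sub, ← h3, symF_actF]

lemma symF_ddWord_mul_div (w : Word r η) (f g : FF r η) :
    symF r η (ddWord r η w f * (g / DeltaF r η)) =
      symF r η (f * (ddWord r η w.reverse g / DeltaF r η)) := by
  induction w generalizing g with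
  | nil => rfl
  | cons s w ih =>
    rw [ddWord_cons, symF_dd_mul_div, ih, List.reverse_cons, ddWord_append]
    rfl

lemma symF_ddWord (w : Word r η) (f : FF r η) :
    symF r η (ddWord r η w f) =
      symF r η (f * (ddWord r η w.reverse (DeltaF r η) / DeltaF r η)) := by
  rw [← symF_ddWord_mul_div, div_self DeltaF_ne_zero, mul_one]

instance : MulSemiringAction (Sg r η) (FF r η) where
  smul σ f := actF r η σ f
  one_smul := actF_one
  mul_smul := actF_mul
  smul_zero σ := map_zero (actF r η σ)
  smul_add σ := map_add (actF r η σ)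
  smul_one σ := map_one (actF r η σ)
  smul_mul σ := map_mul (actF r η σ)

instance : FaithfulSMul (Sg r η) (FF r η) := ⟨fun h => eq_of_actF_eq h⟩

lemma symF_mem_fixedPoints (f : FF r η) :
    symF r η f ∈ FixedPoints.subfield (Sg r η) (FF r η) :=
  fun σ => actF_symF σ f

/-- A family expanding every element of `F` with symmetric coefficients is a basis over the
symmetric functions, so the coefficient functionals form its dual basis. -/
lemma coeff_eq_ite_of_expansion (D : Sg r η → FF r η → FF r η)
    (P : Sg r η → FF r η) (hP : ∀ f : FF r η, f = ∑ σ : Sg r η, symF r η (D σ f) * P σ)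
    (σ τ : Sg r η) : symF r η (D σ (P τ)) = if σ = τ then 1 else 0 := by
  let K := FixedPoints.subfield (Sg r η) (FF r η)
  have hspan : ⊤ ≤ Submodule.span K (Set.range P) := by
    intro f _
    rw [hP f]
    exact Submodule.sum_mem _ fun σ _ => Submodule.smul_mem _
      (⟨symF r η (D σ f), symF_mem_fixedPoints _⟩ : K) (Submodule.subset_span ⟨σ, rfl⟩)
  have hli : LinearIndependent K P :=
    linearIndependent_of_top_le_span_of_card_eq_finrank hspan
      (FixedPoints.finrank_eq_card (Sg r η) (FF r η)).symm
  have h0 := Fintype.linearIndependent_iff.1 hli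
    (fun ρ => (⟨symF r η (D ρ (P τ)), symF_mem_fixedPoints _⟩ : K) - if ρ = τ then 1 else 0) (by
      simp only [sub_smul, ite_smul, one_smul, zero_smul, Finset.sum_sub_distrib,
        Finset.sum_ite_eq', Finset.mem_univ, if_true]
      exact sub_eq_zero.2 (hP (P τ)).symm) σ
  have h1 := congrArg (Subtype.val : K → FF r η) (sub_eq_zero.1 h0)
  rw [apply_ite (Subtype.val : K → FF r η)] at h1
  exact h1

variable {D : Sg r η → FF r η → FF r η}

lemma ddWord_eq_zero_of_not_isRed
    (hD : ∀ (σ : Sg r η) (w : Word r η), IsRed r η σ w → ∀ f, D σ f = ddWord r η w f)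
    (w : Word r η) (hw : w.length ≠ len r η (wordPerm r η w)) (f : FF r η) :
    ddWord r η w f = 0 := by
  induction w with
  | nil => exact absurd (by simp [wordPerm, len_one]) hw
  | cons s w ih =>
    by_cases hred : w.length = len r η (wordPerm r η w)
    · have hlen : len r η (simpleT r η s.1 s.2.1 s.2.2 * wordPerm r η w) + 1 =
          len r η (wordPerm r η w) := by
        refine (len_simpleT_mul s.1 s.2.1 s.2.2 (wordPerm r η w)).resolve_left fun h => hw ?_
        rw [wordPerm_cons, h, List.length_cons, hred]
      obtain ⟨v, hv, hvl⟩ := exists_isRed (simpleT r η s.1 s.2.1 s.2.2 * wordPerm r η w)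
      have hsv : IsRed r η (wordPerm r η w) (s :: v) :=
        ⟨by rw [wordPerm_cons, hv, ← mul_assoc, simpleT_mul_self, one_mul],
          by rw [List.length_cons, hvl, hlen]⟩
      rw [ddWord_cons, ← hD _ w ⟨rfl, hred⟩, hD _ _ hsv, ddWord_cons, dd_dd]
    · rw [ddWord_cons, ih hred, dd_zero]

section Family

variable (hD : ∀ (σ : Sg r η) (w : Word r η), IsRed r η σ w → ∀ f, D σ f = ddWord r η w f)

include hD

lemma apply_mem_diffSpan_pow (σ : Sg r η) {d : ℕ} {f : FF r η}
    (hf : f ∈ diffSpan r η ^ (d + len r η σ)) : D σ f ∈ diffSpan r η ^ d := by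
  obtain ⟨w, hw⟩ := exists_isRed σ
  rw [hD σ w hw]
  exact ddWord_mem_diffSpan_pow w d (by rwa [hw.2])

lemma apply_eq_zero_of_lt_len (σ : Sg r η) {d : ℕ} (hd : d < len r η σ) {f : FF r η}
    (hf : f ∈ diffSpan r η ^ d) : D σ f = 0 := by
  obtain ⟨w, hw⟩ := exists_isRed σ
  rw [hD σ w hw]
  exact ddWord_eq_zero_of_lt w (by rwa [hw.2]) hf

lemma apply_apply_DeltaF {σ τ : Sg r η} (hl : len r η σ = len r η τ) (hne : σ ≠ τ) :
    D σ (D (τ⁻¹ * wEta r η) (DeltaF r η)) = 0 := by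
  obtain ⟨v, hv⟩ := exists_isRed σ
  obtain ⟨w, hw⟩ := exists_isRed (τ⁻¹ * wEta r η)
  rw [hD σ v hv, hD _ w hw, ← ddWord_append]
  refine ddWord_eq_zero_of_not_isRed hD _ (fun h => hne ?_) _
  rw [wordPerm_append, hv.1, hw.1, List.length_append, hv.2, hw.2, hl, ← mul_assoc] at h
  have h1 := len_mul_wEta τ⁻¹
  rw [len_inv] at h1
  exact mul_inv_eq_one.1 (eq_one_of_len_mul_wEta (by omega))

lemma apply_apply_DeltaF_self (τ : Sg r η) :
    D τ (D (τ⁻¹ * wEta r η) (DeltaF r η)) = D (wEta r η) (DeltaF r η) := by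
  obtain ⟨v, hv⟩ := exists_isRed τ
  obtain ⟨w, hw⟩ := exists_isRed (τ⁻¹ * wEta r η)
  rw [hD τ v hv, hD _ w hw, ← ddWord_append]
  refine (hD _ _ ⟨?_, ?_⟩ _).symm
  · rw [wordPerm_append, hv.1, hw.1, mul_inv_cancel_left]
  · have h1 := len_mul_wEta τ⁻¹
    rw [len_inv] at h1
    rw [List.length_append, hv.2, hw.2]
    omega

variable {P : Sg r η → FF r η}
  (hP : ∀ f : FF r η, f = ∑ σ : Sg r η, symF r η (D σ f) * P σ)

include hP

lemma exists_apply_DeltaF : ∃ c : ℂ, c ≠ 0 ∧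
    D (wEta r η) (DeltaF r η) = algebraMap ℂ (FF r η) c := by
  have hmem := apply_mem_diffSpan_pow hD (wEta r η) (d := 0) (by simpa using DeltaF_mem)
  rw [pow_zero, Submodule.mem_one] at hmem
  obtain ⟨c, hc⟩ := hmem
  refine ⟨c, ?_, hc.symm⟩
  rintro rfl
  obtain ⟨w, hw⟩ := exists_isRed (wEta r η)
  have hrev : IsRed r η (wEta r η) w.reverse :=
    ⟨by rw [wordPerm_reverse, hw.1, wEta_inv], by rw [List.length_reverse, hw.2]⟩
  have h1 := coeff_eq_ite_of_expansion D P hP (wEta r η) (wEta r η)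
  rw [hD _ w hw, symF_ddWord, ← hD _ _ hrev, ← hc, map_zero, zero_div, mul_zero, symF_zero,
    if_pos rfl] at h1
  exact zero_ne_one h1

lemma mem_diffSpan_pow_len (τ : Sg r η) : P τ ∈ diffSpan r η ^ len r η τ := by
  induction hn : len r η τ using Nat.strong_induction_on generalizing τ with
  | _ n ih =>
    subst hn
    obtain ⟨c, hc0, hc⟩ := exists_apply_DeltaF hD hP
    set R := D (τ⁻¹ * wEta r η) (DeltaF r η) with hR
    have hRmem : R ∈ diffSpan r η ^ len r η τ := by
      refine apply_mem_diffSpan_pow hD _ ?_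
      have h1 := len_mul_wEta τ⁻¹
      rw [len_inv] at h1
      rw [add_comm, h1]
      exact DeltaF_mem
    have hτ : symF r η (D τ R) = algebraMap ℂ (FF r η) c := by
      rw [hR, apply_apply_DeltaF_self hD, hc, symF_of_invariant]
      exact fun σ => actF_algebraMap_complex σ c
    have hexp := hP R
    rw [← Finset.add_sum_erase _ _ (Finset.mem_univ τ), hτ, ← Algebra.smul_def] at hexp
    have hrest : ∑ σ ∈ Finset.univ.erase τ, symF r η (D σ R) * P σ ∈
        diffSpan r η ^ len r η τ := by
      refine Submodule.sum_mem _ fun σ hσ => ?_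
      rcases lt_trichotomy (len r η σ) (len r η τ) with h | h | h
      · rw [← Nat.sub_add_cancel h.le, pow_add]
        refine Submodule.mul_mem_mul (symF_mem_diffSpan_pow (apply_mem_diffSpan_pow hD σ ?_))
          (ih _ h σ rfl)
        rwa [Nat.sub_add_cancel h.le]
      · rw [apply_apply_DeltaF hD h (Finset.ne_of_mem_erase hσ), symF_zero, zero_mul]
        exact Submodule.zero_mem _
      · rw [apply_eq_zero_of_lt_len hD σ h hRmem, symF_zero, zero_mul]
        exact Submodule.zero_mem _
    rw [hexp, Submodule.add_mem_iff_left _ hrest] at hRmem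
    exact (Submodule.smul_mem_iff _ hc0).1 hRmem

lemma P_one : P 1 = 1 := by
  have h1 := hP 1
  rw [← Finset.add_sum_erase _ _ (Finset.mem_univ 1)] at h1
  have h2 : D 1 1 = 1 := hD 1 [] ⟨rfl, by simp [len_one]⟩ 1
  rw [h2, symF_of_invariant fun σ => map_one _, one_mul, Finset.sum_eq_zero, add_zero] at h1
  · exact h1.symm
  · intro σ hσ
    have hlen : 0 < len r η σ :=
      Nat.pos_of_ne_zero fun h => Finset.ne_of_mem_erase hσ (eq_one_of_len_eq_zero h)
    rw [apply_eq_zero_of_lt_len hD σ hlen (by simp),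
      symF_zero, zero_mul]

end Family

end Helpers

/-- with d^ν_{σ,τ} = D_ν^η(P_σ·P_τ), one has d^ν_{σ,τ} ∈ p_η whenever
ℓ(σ) + ℓ(τ) ≠ ℓ(ν), and d^ν_{ν,id} = d^ν_{id,ν} = 1. -/
theorem statement17 (m r : ℕ) (η : Fin r → ℕ) (hpos : ∀ k, 0 < η k) (hsum : ∑ k, η k = m)
    (Pd : Sg r η → FF r η → FF r η)
    (hPd : ∀ (σ : Sg r η) (w : Word r η), IsRed r η σ w → ∀ f, Pd σ f = ddWord r η w f)
    (P : Sg r η → FF r η)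
    (hP : ∀ f : FF r η, f = ∑ σ : Sg r η, symF r η (Pd σ f) * P σ) :
    ∀ ν σ τ : Sg r η,
      (len r η σ + len r η τ ≠ len r η ν →
        ∃ q ∈ pIdeal r η, symF r η (Pd ν (P σ * P τ)) = algebraMap (Pol r η) (FF r η) q) ∧
      symF r η (Pd ν (P ν * P 1)) = 1 ∧ symF r η (Pd ν (P 1 * P ν)) = 1 := by
  intro ν σ τ
  have hone := P_one hPd hP
  have hν : symF r η (Pd ν (P ν)) = 1 := by
    rw [coeff_eq_ite_of_expansion Pd P hP, if_pos rfl]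
  refine ⟨fun hne => ?_, by rw [hone, mul_one, hν], by rw [hone, one_mul, hν]⟩
  have hmem : P σ * P τ ∈ diffSpan r η ^ (len r η σ + len r η τ) := by
    rw [pow_add]
    exact Submodule.mul_mem_mul (mem_diffSpan_pow_len hPd hP σ) (mem_diffSpan_pow_len hPd hP τ)
  rcases hne.lt_or_gt with h | h
  · refine ⟨0, zero_mem _, ?_⟩
    rw [apply_eq_zero_of_lt_len hPd ν h hmem, symF_zero, map_zero]
  · refine exists_mem_pIdeal (Nat.sub_ne_zero_of_lt h)
      (symF_mem_diffSpan_pow (apply_mem_diffSpan_pow hPd ν ?_))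
    rwa [Nat.sub_add_cancel h.le]
end GTpaper

end
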